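/- arXiv:2010.15286 — 2 statements merged into one kernel-verified Lean document; each statement's English description precedes it below -/
import Mathlib

section
/- Let (A,B,E,E') be an operator-valued infinitesimal probability space, let I be a linearly ordered index set, let (A_i)_{i∈I} be a family of subalgebras of A each containing B, and let (Ã,B̃,Ẽ) be the associated upper triangular probability space with Ã_i ⊆ Ã the corresponding upper triangular subalgebras. Then (A_i)_{i∈I} is infinitesimally monotone independent over B with respect to (E,E') if and only if (Ã_i)_{i∈I} is monotone independent over B̃ with respect to Ẽ, i.e. for every n ≥ 1, all indices i_1,…,i_n ∈ I, every j with i_{j−1} < i_j > i_{j+1} (where the left inequality is dropped if j = 1 and the right one if j = n), and all A_r ∈ Ã_{i_r} (r = 1,…,n), one has Ẽ(A_1⋯A_{j−1}A_jA_{j+1}⋯A_n) = Ẽ(A_1⋯A_{j−1}Ẽ(A_j)A_{j+1}⋯A_n). -/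
noncomputable section

open scoped BigOperators

variable {A : Type*} [Ring A] [Algebra ℂ A] {I : Type*}

/-- `E : A → B` is a conditional expectation onto the unital subalgebra `B`. -/
def IsCondExpectation (B : Subalgebra ℂ A) (E : A →ₗ[ℂ] A) : Prop :=
  (∀ a, E a ∈ B) ∧ (∀ b ∈ B, E b = b) ∧
    ∀ a : A, ∀ b ∈ B, ∀ b' ∈ B, E (b * a * b') = b * E a * b'

/-- `E' : A → B` is an infinitesimal conditional expectation. -/
def IsInfCondExpectation (B : Subalgebra ℂ A) (E' : A →ₗ[ℂ] A) : Prop :=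
  (∀ a, E' a ∈ B) ∧ E' 1 = 0 ∧
    ∀ a : A, ∀ b ∈ B, ∀ b' ∈ B, E' (b * a * b') = b * E' a * b'

/-- The subalgebras `Asub i`, for `i` in a linearly ordered index set `I`, are
infinitesimally monotone independent over `B` with respect to `(E, E')`: whenever
`a_r ∈ A_{i_r}` and `i_{j-1} < i_j > i_{j+1}` (one inequality dropped if `j = 1` or
`j = n`), one has `E(a_1⋯a_j⋯a_n) = E(a_1⋯E(a_j)⋯a_n)` and
`E'(a_1⋯a_j⋯a_n) = E(a_1⋯E'(a_j)⋯a_n) + E'(a_1⋯E(a_j)⋯a_n)`. -/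
def InfMonotoneIndep [LinearOrder I] (E E' : A →ₗ[ℂ] A) (Asub : I → Subalgebra ℂ A) : Prop :=
  ∀ (n : ℕ) (idx : Fin n → I) (j : Fin n),
    (∀ k : Fin n, k.val + 1 = j.val → idx k < idx j) →
    (∀ k : Fin n, j.val + 1 = k.val → idx k < idx j) →
    ∀ a : Fin n → A, (∀ k, a k ∈ Asub (idx k)) →
      E (List.ofFn a).prod = E (List.ofFn (Function.update a j (E (a j)))).prod ∧
      E' (List.ofFn a).prod =
        E (List.ofFn (Function.update a j (E' (a j)))).prod +
        E' (List.ofFn (Function.update a j (E (a j)))).prod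

/-- The map `Ẽ` on the upper triangular algebra `Ã` (realized as the square-zero
extension `DualNumber A` of `A` by itself, i.e. matrices `[[a, a'], [0, a]]`). -/
def tildeE (E E' : A →ₗ[ℂ] A) (X : DualNumber A) : DualNumber A :=
  TrivSqZeroExt.inl (E X.fst) + TrivSqZeroExt.inr (E X.snd + E' X.fst)

/-- The derivation rule for the `snd` component of an ordered product of dual numbers. -/
theorem DualNumber.snd_prod_ofFn {R : Type*} [Ring R] :
    ∀ {n : ℕ} (X : Fin n → DualNumber R),
      (List.ofFn X).prod.snd =
        ∑ k, (List.ofFn (Function.update (fun i => (X i).fst) k (X k).snd)).prod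
  | 0, X => by simp
  | n + 1, X => by
    have h0 : ∀ Y : Fin (n + 1) → R, (List.ofFn Y).prod =
        Y 0 * (List.ofFn fun i => Y i.succ).prod := fun Y => by simp [List.ofFn_succ]
    have hs : ∀ k : Fin n,
        (fun i : Fin n => Function.update (fun i => (X i).fst) k.succ (X k.succ).snd i.succ) =
          Function.update (fun i : Fin n => (X i.succ).fst) k (X k.succ).snd := fun k => by
      ext i
      simp [Function.update_apply]
    have hz : ∀ k : Fin n,
        Function.update (fun i => (X i).fst) k.succ (X k.succ).snd 0 = (X 0).fst := fun k =>
      Function.update_of_ne (Fin.succ_ne_zero k).symm _ _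
    simp_rw [Fin.sum_univ_succ, h0, hs, hz]
    rw [List.ofFn_succ, List.prod_cons, DualNumber.snd_mul, snd_prod_ofFn,
      TrivSqZeroExt.fst_list_prod]
    simp [Finset.mul_sum, List.map_ofFn, Function.comp_def, add_comm]

theorem DualNumber.fst_prod_ofFn {R : Type*} [Ring R] {n : ℕ} (X : Fin n → DualNumber R) :
    (List.ofFn X).prod.fst = (List.ofFn fun i => (X i).fst).prod := by
  rw [TrivSqZeroExt.fst_list_prod, List.map_ofFn, Function.comp_def]

theorem List.prod_ofFn_update_add {R : Type*} [Ring R] {n : ℕ} (a : Fin n → R) (j : Fin n)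
    (x y : R) :
    (List.ofFn (Function.update a j (x + y))).prod =
      (List.ofFn (Function.update a j x)).prod + (List.ofFn (Function.update a j y)).prod := by
  simpa only [MultilinearMap.mkPiAlgebraFin_apply] using
    (MultilinearMap.mkPiAlgebraFin ℤ n R).map_update_add a j x y

theorem List.prod_ofFn_update_zero {R : Type*} [Ring R] {n : ℕ} (a : Fin n → R) (j : Fin n) :
    (List.ofFn (Function.update a j 0)).prod = 0 :=
  List.prod_eq_zero ((List.mem_ofFn' _ _).2 ⟨j, Function.update_self ..⟩)

@[simp]
theorem tildeE_fst (E E' : A →ₗ[ℂ] A) (X : DualNumber A) : (tildeE E E' X).fst = E X.fst := by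
  simp [tildeE]

@[simp]
theorem tildeE_snd (E E' : A →ₗ[ℂ] A) (X : DualNumber A) :
    (tildeE E E' X).snd = E X.snd + E' X.fst := by
  simp [tildeE]

theorem fst_update_tildeE (E E' : A →ₗ[ℂ] A) {n : ℕ} (X : Fin n → DualNumber A) (j : Fin n) :
    (fun i => (Function.update X j (tildeE E E' (X j)) i).fst) =
      Function.update (fun i => (X i).fst) j (E (X j).fst) := by
  ext i
  by_cases h : i = j
  · subst h; simp
  · simp [h]

/-- The `snd` component of a product in which the `j`-th factor is replaced by its image
under `tildeE`, with the contribution of the `j`-th factor isolated. -/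
theorem snd_prod_update_tildeE (E E' : A →ₗ[ℂ] A) {n : ℕ} (X : Fin n → DualNumber A)
    (j : Fin n) :
    (List.ofFn (Function.update X j (tildeE E E' (X j)))).prod.snd =
      (List.ofFn (Function.update (fun i => (X i).fst) j (E' (X j).fst))).prod +
      ((List.ofFn (Function.update (fun i => (X i).fst) j (E (X j).snd))).prod +
        ∑ k ∈ Finset.univ.erase j, (List.ofFn (Function.update
          (Function.update (fun i => (X i).fst) k (X k).snd) j (E (X j).fst))).prod) := by
  rw [DualNumber.snd_prod_ofFn, fst_update_tildeE, ← Finset.add_sum_erase _ _ (Finset.mem_univ j),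
    Function.update_self, tildeE_snd, Function.update_idem, List.prod_ofFn_update_add,
    ← add_assoc, add_comm (List.prod _) (List.prod _)]
  congr 1
  refine Finset.sum_congr rfl fun k hk => ?_
  have hkj := Finset.ne_of_mem_erase hk
  rw [Function.update_of_ne hkj, Function.update_comm hkj.symm]

/-- Proposition: `(A_i)` are infinitesimally monotone independent over `B` with respect
to `(E, E')` iff the upper triangular subalgebras `(Ã_i)` are monotone independent over
`B̃` with respect to `Ẽ`. -/
theorem infMonotone_iff_monotone_upper_triangular [LinearOrder I]
    (B : Subalgebra ℂ A) (E E' : A →ₗ[ℂ] A)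
    (hE : IsCondExpectation B E) (hE' : IsInfCondExpectation B E')
    (Asub : I → Subalgebra ℂ A) (hB : ∀ i, B ≤ Asub i) :
    InfMonotoneIndep E E' Asub ↔
      ∀ (n : ℕ) (idx : Fin n → I) (j : Fin n),
        (∀ k : Fin n, k.val + 1 = j.val → idx k < idx j) →
        (∀ k : Fin n, j.val + 1 = k.val → idx k < idx j) →
        ∀ X : Fin n → DualNumber A,
          (∀ k, (X k).fst ∈ Asub (idx k) ∧ (X k).snd ∈ Asub (idx k)) →
          tildeE E E' (List.ofFn X).prod =
            tildeE E E' (List.ofFn (Function.update X j (tildeE E E' (X j)))).prod := by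
  constructor
  · intro h n idx j hl hr X hX
    have hfst := h n idx j hl hr (fun i => (X i).fst) fun k => (hX k).1
    have hsnd : ∀ k, ∀ i, Function.update (fun i => (X i).fst) k (X k).snd i ∈ Asub (idx i) := by
      intro k i
      by_cases hik : i = k
      · subst hik; simpa using (hX i).2
      · simpa [hik] using (hX i).1
    have hj := (h n idx j hl hr _ (hsnd j)).1
    rw [Function.update_self, Function.update_idem] at hj
    ext
    · rw [tildeE_fst, tildeE_fst, DualNumber.fst_prod_ofFn, DualNumber.fst_prod_ofFn,
        fst_update_tildeE]
      exact hfst.1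
    · rw [tildeE_snd, tildeE_snd, DualNumber.fst_prod_ofFn, DualNumber.fst_prod_ofFn,
        fst_update_tildeE, snd_prod_update_tildeE, DualNumber.snd_prod_ofFn,
        ← Finset.add_sum_erase _ _ (Finset.mem_univ j), hfst.2]
      have hsum : ∑ k ∈ Finset.univ.erase j,
            E (List.ofFn (Function.update (fun i => (X i).fst) k (X k).snd)).prod =
          ∑ k ∈ Finset.univ.erase j, E (List.ofFn (Function.update
            (Function.update (fun i => (X i).fst) k (X k).snd) j (E (X j).fst))).prod := by
        refine Finset.sum_congr rfl fun k hk => ?_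
        have hk' := (h n idx j hl hr _ (hsnd k)).1
        rwa [Function.update_of_ne (Finset.ne_of_mem_erase hk).symm] at hk'
      simp only [map_add, map_sum, hj, hsum]
      abel
  · intro h n idx j hl hr a ha
    have key := h n idx j hl hr (fun i => TrivSqZeroExt.inl (a i))
      fun k => ⟨ha k, (Asub (idx k)).zero_mem⟩
    have hfst := congrArg TrivSqZeroExt.fst key
    have hsnd := congrArg TrivSqZeroExt.snd key
    rw [tildeE_fst, tildeE_fst, DualNumber.fst_prod_ofFn, DualNumber.fst_prod_ofFn,
      fst_update_tildeE] at hfst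
    rw [tildeE_snd, tildeE_snd, DualNumber.fst_prod_ofFn, DualNumber.fst_prod_ofFn,
      fst_update_tildeE, snd_prod_update_tildeE, DualNumber.snd_prod_ofFn] at hsnd
    have hzero : ∀ k ∈ Finset.univ.erase j, (List.ofFn (Function.update
        (Function.update a k 0) j (E (a j)))).prod = 0 := fun k hk => by
      rw [Function.update_comm (Finset.ne_of_mem_erase hk), List.prod_ofFn_update_zero]
    simp only [TrivSqZeroExt.fst_inl, TrivSqZeroExt.snd_inl, map_zero,
      List.prod_ofFn_update_zero, Finset.sum_const_zero, zero_add,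
      Finset.sum_eq_zero hzero, add_zero] at hfst hsnd
    exact ⟨hfst, hsnd⟩
end
end

section
/- Let (A,φ,φ') be an infinitesimal probability space and let (a_i)_{i≥1} be an infinitesimally Boolean independent sequence in A with identical distribution (for every k ≥ 1, φ(a_i^k) and φ'(a_i^k) do not depend on i) satisfying φ(a_1) = φ'(a_1) = 0, φ(a_1²) = 1 and φ'(a_1²) = α. Let S_N = (a_1 + ⋯ + a_N)/√N. Then for every k ≥ 1: lim_{N→∞} φ(S_N^k) = 1 if k is even and 0 if k is odd, and lim_{N→∞} φ'(S_N^k) = α·k/2 if k is even and 0 if k is odd. -/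
noncomputable section

open scoped BigOperators
open Filter Topology

variable {A : Type*} [Ring A] [Algebra ℂ A]

/-- The non-unital subalgebras `S i` are infinitesimally Boolean independent with respect
to `(φ, φ')`: for adjacent-distinct indices and `x_j ∈ S i_j`,
`φ(x_1⋯x_n) = φ(x_1)⋯φ(x_n)` and `φ'(x_1⋯x_n) = Σ_j φ(x_1)⋯φ'(x_j)⋯φ(x_n)`. -/
def InfBooleanSeq (φ φ' : A → ℂ) (S : ℕ → NonUnitalSubalgebra ℂ A) : Prop :=
  ∀ n : ℕ, 0 < n → ∀ idx : Fin n → ℕ,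
    (∀ (k : Fin n) (h : k.val + 1 < n), idx k ≠ idx ⟨k.val + 1, h⟩) →
    ∀ x : Fin n → A, (∀ k, x k ∈ S (idx k)) →
      φ (List.ofFn x).prod = ∏ k, φ (x k) ∧
      φ' (List.ofFn x).prod = ∑ j, φ' (x j) * ∏ k ∈ Finset.univ.erase j, φ (x k)

theorem DualNumber.snd_prod {R ι : Type*} [CommRing R] [DecidableEq ι] (s : Finset ι)
    (f : ι → DualNumber R) :
    (∏ i ∈ s, f i).snd = ∑ j ∈ s, (f j).snd * ∏ k ∈ s.erase j, (f k).fst := by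
  have hfst (t : Finset ι) : (∏ i ∈ t, f i).fst = ∏ i ∈ t, (f i).fst :=
    map_prod (TrivSqZeroExt.fstHom R R R) f t
  induction s using Finset.induction_on with
  | empty => simp
  | insert i s hi ih =>
    rw [Finset.prod_insert hi, TrivSqZeroExt.snd_mul, ih, hfst, Finset.sum_insert hi,
      Finset.erase_insert hi, add_comm]
    simp only [smul_eq_mul, MulOpposite.smul_eq_mul_unop, MulOpposite.unop_op, Finset.mul_sum]
    congr 1
    refine Finset.sum_congr rfl fun j hj => ?_
    have hij : i ≠ j := fun h => hi (h ▸ hj)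
    rw [Finset.erase_insert_of_ne hij, Finset.prod_insert (by simp [hi])]
    ring

/-- The functional `φ + ε φ'` with values in the dual numbers. -/
def dualFunctional (φ φ' : A →ₗ[ℂ] ℂ) : A →ₗ[ℂ] DualNumber ℂ :=
  (TrivSqZeroExt.inlAlgHom ℂ ℂ ℂ).toLinearMap ∘ₗ φ + TrivSqZeroExt.inrHom ℂ ℂ ∘ₗ φ'

section Boolean

variable {C : Type*} [CommRing C] [Algebra ℂ C]

/-- `Φ` factorizes over products of powers `a i ^ l`, `l ≥ 1`, with adjacent indices distinct. -/
def FactorizesOnPowers (Φ : A →ₗ[ℂ] C) (a : ℕ → A) : Prop :=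
  ∀ L : List (ℕ × ℕ), (L.map Prod.fst).IsChain (· ≠ ·) → (∀ p ∈ L, 1 ≤ p.2) →
    Φ (L.map fun p => a p.1 ^ p.2).prod = (L.map fun p => Φ (a p.1 ^ p.2)).prod

/-- The span of the alternating products of powers `a j ^ l`, `l ≥ 1`, whose first index is
not `i`. -/
def alternatingSpan (a : ℕ → A) (i : ℕ) : Submodule ℂ A :=
  Submodule.span ℂ {y | ∃ L : List (ℕ × ℕ), (i :: L.map Prod.fst).IsChain (· ≠ ·) ∧
    (∀ p ∈ L, 1 ≤ p.2) ∧ y = (L.map fun p => a p.1 ^ p.2).prod}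

theorem one_mem_alternatingSpan (a : ℕ → A) (i : ℕ) : 1 ∈ alternatingSpan a i :=
  Submodule.subset_span ⟨[], by simp⟩

theorem pow_mul_mem_alternatingSpan {a : ℕ → A} {i j l : ℕ} (hij : i ≠ j) (hl : 1 ≤ l) {y : A}
    (hy : y ∈ alternatingSpan a j) : a j ^ l * y ∈ alternatingSpan a i := by
  induction hy using Submodule.span_induction with
  | mem y hy =>
    obtain ⟨L, hL, hpos, rfl⟩ := hy
    refine Submodule.subset_span ⟨(j, l) :: L, ?_, ?_, by simp⟩
    · simpa [hij] using hL
    · simpa [hl] using hpos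
  | zero => simp
  | add x y _ _ hx hy => rw [mul_add]; exact add_mem hx hy
  | smul c x _ hx => rw [mul_smul_comm]; exact Submodule.smul_mem _ _ hx

theorem FactorizesOnPowers.map_pow_mul {Φ : A →ₗ[ℂ] C} {a : ℕ → A}
    (h : FactorizesOnPowers Φ a) {i l : ℕ} (hl : 1 ≤ l) {y : A}
    (hy : y ∈ alternatingSpan a i) : Φ (a i ^ l * y) = Φ (a i ^ l) * Φ y := by
  induction hy using Submodule.span_induction with
  | mem y hy =>
    obtain ⟨L, hL, hpos, rfl⟩ := hy
    have := h ((i, l) :: L) (by simpa using hL) (by simpa [hl] using hpos)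
    rw [h L hL.tail hpos]
    simpa using this
  | zero => simp
  | add x y _ _ hx hy => rw [mul_add, map_add, map_add, hx, hy, mul_add]
  | smul c x _ hx => rw [mul_smul_comm, map_smul, map_smul, hx, mul_smul_comm]

/-- With `S = ∑ i < N, a i`, this is the sum of the words of length `n` in
`a 0, …, a (N - 1)` that do not start with `a i`. -/
def wordsAvoiding (a : ℕ → A) (N i : ℕ) : ℕ → A
  | 0 => 1
  | n + 1 => (∑ j ∈ Finset.range N, a j) ^ (n + 1) - a i * (∑ j ∈ Finset.range N, a j) ^ n

theorem wordsAvoiding_mem_and_pow_mul_sum_pow_mem (a : ℕ → A) (N n : ℕ) :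
    ∀ i < N, wordsAvoiding a N i n ∈ alternatingSpan a i ∧ ∀ j < N, i ≠ j → ∀ l, 1 ≤ l →
      a j ^ l * (∑ j ∈ Finset.range N, a j) ^ n ∈ alternatingSpan a i := by
  induction n with
  | zero =>
    intro i _
    refine ⟨one_mem_alternatingSpan a i, fun j _ hij l hl => ?_⟩
    rw [pow_zero]
    exact pow_mul_mem_alternatingSpan hij hl (one_mem_alternatingSpan a j)
  | succ n ih =>
    have hwords : ∀ i < N, wordsAvoiding a N i (n + 1) ∈ alternatingSpan a i := by
      intro i hi
      have : wordsAvoiding a N i (n + 1) = ∑ j ∈ (Finset.range N).erase i,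
          a j ^ 1 * (∑ j ∈ Finset.range N, a j) ^ n := by
        rw [wordsAvoiding, pow_succ', ← sub_mul,
          ← Finset.sum_erase_eq_sub (Finset.mem_range.mpr hi), Finset.sum_mul]
        simp
      rw [this]
      refine Submodule.sum_mem _ fun j hj => ?_
      rw [Finset.mem_erase, Finset.mem_range] at hj
      exact (ih i hi).2 j hj.2 hj.1.symm 1 le_rfl
    refine fun i hi => ⟨hwords i hi, fun j hj hij l hl => ?_⟩
    have : a j ^ l * (∑ j ∈ Finset.range N, a j) ^ (n + 1) =
        a j ^ l * wordsAvoiding a N j (n + 1) +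
          a j ^ (l + 1) * (∑ j ∈ Finset.range N, a j) ^ n := by
      rw [wordsAvoiding, pow_succ (a j) l]
      noncomm_ring
    rw [this]
    exact add_mem (pow_mul_mem_alternatingSpan hij hl (hwords j hj))
      ((ih i hi).2 j hj hij (l + 1) (by omega))

/-- Decomposition of `a i ^ (l + 1) * S ^ n` according to the length of the first block. -/
theorem pow_succ_mul_sum_pow {R : Type*} [Ring R] (a : ℕ → R) (N i n l : ℕ) :
    a i ^ (l + 1) * (∑ j ∈ Finset.range N, a j) ^ n =
      ∑ p ∈ Finset.HasAntidiagonal.antidiagonal n,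
        a i ^ (l + 1 + p.1) * wordsAvoiding a N i p.2 := by
  induction n generalizing l with
  | zero => simp [wordsAvoiding]
  | succ n ih =>
    rw [Finset.Nat.sum_antidiagonal_succ]
    have := ih (l + 1)
    have hexp (p : ℕ) : a i ^ (l + 1 + (p + 1)) = a i ^ (l + 1 + 1 + p) := by
      congr 1; ring
    rw [Finset.sum_congr rfl fun (p : ℕ × ℕ) _ =>
        congrArg (· * wordsAvoiding a N i p.2) (hexp p.1),
      ← this, wordsAvoiding, add_zero, pow_succ (a i) (l + 1)]
    noncomm_ring

/-- The generating series of the moments of `x`. -/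
def momentSeries (Φ : A →ₗ[ℂ] C) (x : A) : PowerSeries C := PowerSeries.mk fun n => Φ (x ^ n)

/-- The Boolean cumulant series is additive: if `b` is the common Boolean cumulant series of
the `a i`, that of their sum is `N • b`. -/
theorem FactorizesOnPowers.momentSeries_sum {Φ : A →ₗ[ℂ] C} {a : ℕ → A} (h1 : Φ 1 = 1)
    (h : FactorizesOnPowers Φ a) {b : PowerSeries C}
    (hb : ∀ i, momentSeries Φ (a i) = 1 + b * momentSeries Φ (a i)) (N : ℕ) :
    momentSeries Φ (∑ j ∈ Finset.range N, a j) =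
      1 + (N : PowerSeries C) * b * momentSeries Φ (∑ j ∈ Finset.range N, a j) := by
  set S := ∑ j ∈ Finset.range N, a j with hS
  set T : ℕ → PowerSeries C := fun i => PowerSeries.mk fun n => Φ (wordsAvoiding a N i n) with hT
  set D : ℕ → PowerSeries C := fun i => PowerSeries.mk fun n => Φ (a i * S ^ n) with hD
  have hM : momentSeries Φ S = 1 + PowerSeries.X * ∑ i ∈ Finset.range N, D i := by
    ext n
    cases n with
    | zero => simp [momentSeries, h1]
    | succ n =>
      simp only [momentSeries, hD, map_add, PowerSeries.coeff_succ_X_mul, map_sum,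
        PowerSeries.coeff_mk, PowerSeries.coeff_one]
      rw [pow_succ', hS, Finset.sum_mul, map_sum]
      simp
  have hMT (i : ℕ) : momentSeries Φ S = T i + PowerSeries.X * D i := by
    ext n
    cases n with
    | zero => simp [momentSeries, hT, wordsAvoiding]
    | succ n => simp [momentSeries, hT, hD, wordsAvoiding, PowerSeries.coeff_succ_X_mul, hS]
  have hDT (i : ℕ) (hi : i < N) : T i + PowerSeries.X * D i = momentSeries Φ (a i) * T i := by
    ext n
    cases n with
    | zero => simp [momentSeries, hT, wordsAvoiding, PowerSeries.coeff_mul, h1]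
    | succ n =>
      rw [map_add, PowerSeries.coeff_succ_X_mul, PowerSeries.coeff_mul,
        Finset.Nat.sum_antidiagonal_succ]
      simp only [momentSeries, hT, hD, PowerSeries.coeff_mk, pow_zero, h1, one_mul]
      congr 1
      have := pow_succ_mul_sum_pow a N i n 0
      rw [zero_add, pow_one, ← hS] at this
      rw [this, map_sum]
      refine Finset.sum_congr rfl fun p _ => ?_
      rw [h.map_pow_mul (by omega) (wordsAvoiding_mem_and_pow_mul_sum_pow_mem a N p.2 i hi).1,
        add_comm 1]
  have hDb (i : ℕ) (hi : i < N) : PowerSeries.X * D i = b * momentSeries Φ S := by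
    linear_combination (1 - b) * hDT i hi - b * hMT i + T i * hb i
  have : PowerSeries.X * ∑ i ∈ Finset.range N, D i =
      (N : PowerSeries C) * b * momentSeries Φ S := by
    rw [Finset.mul_sum, Finset.sum_congr rfl fun i hi => hDb i (Finset.mem_range.mp hi)]
    simp [mul_assoc]
  rw [← this, ← hM]

theorem tendsto_inv_sqrt_pow_mul (p : ℕ) (hp : 2 ≤ p) :
    Tendsto (fun N : ℕ => ((Real.sqrt N : ℂ))⁻¹ ^ p * (N : ℂ)) atTop
      (𝓝 (if p = 2 then 1 else 0)) := by
  obtain ⟨q, rfl⟩ := Nat.exists_eq_add_of_le hp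
  have h0 : Tendsto (fun N : ℕ => ((Real.sqrt N : ℂ))⁻¹) atTop (𝓝 0) := by
    have : Tendsto (fun N : ℕ => (Real.sqrt N)⁻¹) atTop (𝓝 0) :=
      tendsto_inv_atTop_zero.comp (Real.tendsto_sqrt_atTop.comp tendsto_natCast_atTop_atTop)
    simpa [Function.comp_def] using (Complex.continuous_ofReal.tendsto 0).comp this
  have h := h0.pow q
  rw [zero_pow_eq] at h
  simp only [Nat.add_eq_left]
  refine h.congr' ?_
  filter_upwards [eventually_ge_atTop 1] with N hN
  have hN0 : (N : ℂ) ≠ 0 := by exact_mod_cast (by omega : N ≠ 0)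
  have hsq : ((Real.sqrt N : ℂ)) ^ 2 = N := by
    exact_mod_cast Real.sq_sqrt (Nat.cast_nonneg N)
  rw [pow_add, inv_pow _ 2, hsq]
  field_simp

/-- The Boolean central limit theorem for functionals valued in a commutative algebra. -/
theorem FactorizesOnPowers.tendsto_moment [TopologicalSpace C] [IsTopologicalRing C]
    [ContinuousSMul ℂ C] {Φ : A →ₗ[ℂ] C} {a : ℕ → A} (h1 : Φ 1 = 1)
    (h : FactorizesOnPowers Φ a) (hident : ∀ k i j, Φ (a i ^ k) = Φ (a j ^ k))
    (hmean : Φ (a 0) = 0) (k : ℕ) :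
    Tendsto (fun N : ℕ => Φ ((((Real.sqrt N : ℂ))⁻¹ • ∑ i ∈ Finset.range N, a i) ^ k))
      atTop (𝓝 (if Even k then Φ (a 0 ^ 2) ^ (k / 2) else 0)) := by
  set m := momentSeries Φ (a 0) with hm
  have hm0 : PowerSeries.constantCoeff m = ((1 : Cˣ) : C) := by
    simp [hm, momentSeries, ← PowerSeries.coeff_zero_eq_constantCoeff_apply, h1]
  have hinv := PowerSeries.mul_invOfUnit m 1 hm0
  set b := 1 - PowerSeries.invOfUnit m 1 with hb
  have hbm : m = 1 + b * m := by rw [hb]; linear_combination hinv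
  have hmi (i : ℕ) : momentSeries Φ (a i) = m := by
    ext n; simp [hm, momentSeries, hident n i 0]
  have hc0 : PowerSeries.coeff 0 b = 0 := by
    have := congrArg (PowerSeries.coeff 0) hbm
    simpa [PowerSeries.coeff_mul, hm, momentSeries, h1] using this
  have hc1 : PowerSeries.coeff 1 b = 0 := by
    have := congrArg (PowerSeries.coeff 1) hbm
    simp only [map_add, PowerSeries.coeff_mul, Finset.Nat.sum_antidiagonal_succ, hc0] at this
    simpa [hm, momentSeries, h1, hmean, PowerSeries.coeff_one] using this.symm
  have hc2 : PowerSeries.coeff 2 b = Φ (a 0 ^ 2) := by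
    have := congrArg (PowerSeries.coeff 2) hbm
    simp only [map_add, PowerSeries.coeff_mul, Finset.Nat.sum_antidiagonal_succ, hc0] at this
    simpa [hm, momentSeries, h1, hc1, PowerSeries.coeff_one] using this.symm
  have hrec (N n : ℕ) : Φ ((((Real.sqrt N : ℂ))⁻¹ • ∑ i ∈ Finset.range N, a i) ^ (n + 1)) =
      ∑ p ∈ Finset.HasAntidiagonal.antidiagonal n,
        ((((Real.sqrt N : ℂ))⁻¹ ^ (p.1 + 1) * (N : ℂ)) • PowerSeries.coeff (p.1 + 1) b) *
          Φ ((((Real.sqrt N : ℂ))⁻¹ • ∑ i ∈ Finset.range N, a i) ^ p.2) := by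
    have := congrArg (PowerSeries.coeff (n + 1))
      (h.momentSeries_sum h1 (b := b) (fun i => by rw [hmi]; exact hbm) N)
    rw [map_add, mul_assoc, ← nsmul_eq_mul, map_nsmul, PowerSeries.coeff_mul,
      Finset.Nat.sum_antidiagonal_succ, hc0] at this
    simp only [momentSeries, PowerSeries.coeff_mk, PowerSeries.coeff_one, Nat.add_eq_zero_iff,
      one_ne_zero, and_false, if_false, zero_mul, zero_add] at this
    rw [smul_pow, map_smul, this, Finset.smul_sum, Finset.smul_sum]
    refine Finset.sum_congr rfl fun p hp => ?_
    rw [Finset.HasAntidiagonal.mem_antidiagonal] at hp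
    rw [smul_pow, map_smul, smul_mul_smul_comm, ← Nat.cast_smul_eq_nsmul ℂ, smul_smul, ← hp]
    congr 1
    ring
  induction k using Nat.strong_induction_on with
  | _ k ih =>
    cases k with
    | zero => simpa [h1] using tendsto_const_nhds
    | succ n =>
      simp only [hrec]
      have hlim : (if Even (n + 1) then Φ (a 0 ^ 2) ^ ((n + 1) / 2) else 0) =
          ∑ p ∈ Finset.HasAntidiagonal.antidiagonal n, (if p.1 = 1 then Φ (a 0 ^ 2) else 0) *
            (if Even p.2 then Φ (a 0 ^ 2) ^ (p.2 / 2) else 0) := by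
        cases n with
        | zero => simp
        | succ n =>
          rw [Finset.sum_eq_single (1, n)]
          · have : (n + 1 + 1) / 2 = n / 2 + 1 := by omega
            simp [this, pow_succ', Nat.even_add_one]
          · rintro ⟨p, q⟩ hpq hne
            have : p ≠ 1 := by
              rintro rfl
              rw [Finset.HasAntidiagonal.mem_antidiagonal] at hpq
              exact hne (by ext <;> simp; omega)
            simp [this]
          · intro hn
            exact absurd (by rw [Finset.HasAntidiagonal.mem_antidiagonal]; omega) hn
      rw [hlim]
      refine tendsto_finsetSum _ fun p hp => ?_
      rw [Finset.HasAntidiagonal.mem_antidiagonal] at hp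
      refine Tendsto.mul ?_ (ih p.2 (by omega))
      rcases Nat.eq_zero_or_pos p.1 with hp0 | hp0
      · simpa [hp0, hc1] using tendsto_const_nhds
      · have := (tendsto_inv_sqrt_pow_mul (p.1 + 1) (by omega)).smul_const
          (PowerSeries.coeff (p.1 + 1) b)
        convert this using 2
        by_cases hp1 : p.1 = 1
        · simp [hp1, hc2]
        · simp [hp1]

end Boolean

theorem map_eq_ofFn_getElem {β γ : Type*} (f : β → γ) (L : List β) :
    L.map f = List.ofFn fun k : Fin L.length => f L[k] := by
  apply List.ext_getElem <;> simp

theorem InfBooleanSeq.factorizesOnPowers {φ φ' : A →ₗ[ℂ] ℂ} (hφ1 : φ 1 = 1) (hφ'1 : φ' 1 = 0)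
    {a : ℕ → A} (hindep : InfBooleanSeq ⇑φ ⇑φ' fun i => NonUnitalAlgebra.adjoin ℂ {a i}) :
    FactorizesOnPowers (dualFunctional φ φ') a := by
  intro L hL hpos
  rcases Nat.eq_zero_or_pos L.length with hlen | hlen
  · rw [List.length_eq_zero_iff] at hlen
    subst hlen
    ext <;> simp [dualFunctional, hφ1, hφ'1]
  have hmem (i l : ℕ) (hl : 1 ≤ l) : a i ^ l ∈ NonUnitalAlgebra.adjoin ℂ {a i} := by
    induction l, hl using Nat.le_induction with
    | base => rw [pow_one]; exact NonUnitalAlgebra.self_mem_adjoin_singleton ℂ (a i)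
    | succ l _ ih =>
      rw [pow_succ]
      exact mul_mem ih (NonUnitalAlgebra.self_mem_adjoin_singleton ℂ (a i))
  obtain ⟨hfst, hsnd⟩ := hindep L.length hlen (fun k => L[k].1)
    (fun k hk => by
      have := List.isChain_iff_getElem.mp hL k (by simpa using hk)
      simpa using this)
    (fun k => a L[k].1 ^ L[k].2)
    (fun k => hmem _ _ (hpos _ (List.getElem_mem _)))
  rw [map_eq_ofFn_getElem, map_eq_ofFn_getElem, List.prod_ofFn (M := DualNumber ℂ)]
  ext
  · refine Eq.trans ?_ ((hfst.trans ?_).trans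
      (map_prod (TrivSqZeroExt.fstHom ℂ ℂ ℂ) _ Finset.univ).symm)
    · simp [dualFunctional]
    · simp [dualFunctional]
  · rw [DualNumber.snd_prod]
    simpa [dualFunctional] using hsnd

/-- Theorem (infinitesimal Boolean CLT, moment form): for an infinitesimally Boolean
independent, identically distributed sequence `(aᵢ)` with `φ(a₁) = φ'(a₁) = 0`,
`φ(a₁²) = 1`, `φ'(a₁²) = α`, the moments of `S_N = (a₁+⋯+a_N)/√N` converge to `1` for
even `k` (and `0` for odd `k`), and the infinitesimal moments converge to `α·k/2` for
even `k` (and `0` for odd `k`). -/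
theorem infinitesimal_boolean_clt
    (φ φ' : A →ₗ[ℂ] ℂ) (hφ1 : φ 1 = 1) (hφ'1 : φ' 1 = 0)
    (a : ℕ → A) (α : ℂ)
    (hindep : InfBooleanSeq ⇑φ ⇑φ' fun i => NonUnitalAlgebra.adjoin ℂ {a i})
    (hident : ∀ k : ℕ, 1 ≤ k → ∀ i j : ℕ, φ (a i ^ k) = φ (a j ^ k) ∧ φ' (a i ^ k) = φ' (a j ^ k))
    (h1 : φ (a 0) = 0) (h1' : φ' (a 0) = 0)
    (h2 : φ (a 0 ^ 2) = 1) (h2' : φ' (a 0 ^ 2) = α)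
    (k : ℕ) (hk : 1 ≤ k) :
    Tendsto
      (fun N : ℕ => φ ((((Real.sqrt N : ℂ))⁻¹ • ∑ i ∈ Finset.range N, a i) ^ k))
      atTop (𝓝 (if Even k then (1 : ℂ) else 0)) ∧
    Tendsto
      (fun N : ℕ => φ' ((((Real.sqrt N : ℂ))⁻¹ • ∑ i ∈ Finset.range N, a i) ^ k))
      atTop (𝓝 (if Even k then α * ((k / 2 : ℕ) : ℂ) else 0)) := by
  have hlim := (hindep.factorizesOnPowers hφ1 hφ'1).tendsto_moment
    (by ext <;> simp [dualFunctional, hφ1, hφ'1])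
    (fun k i j => by
      rcases Nat.eq_zero_or_pos k with rfl | hk
      · simp
      · ext
        · simpa [dualFunctional] using (hident k hk i j).1
        · simpa [dualFunctional] using (hident k hk i j).2)
    (by ext <;> simp [dualFunctional, h1, h1']) k
  constructor
  · have := (TrivSqZeroExt.continuous_fst.tendsto _).comp hlim
    convert this using 2
    · simp [dualFunctional]
    · split_ifs <;> simp [dualFunctional, h2]
  · have := (TrivSqZeroExt.continuous_snd.tendsto _).comp hlim
    convert this using 2
    · simp [dualFunctional]
    · split_ifs <;> simp [dualFunctional, h2, h2', TrivSqZeroExt.snd_pow, mul_comm]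
end
end
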